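/- arXiv:2106.06212 — 3 statements merged into one kernel-verified Lean document; each statement's English description precedes it below -/
import Mathlib

section
/- Let τ be a faithful positive tracial state on ℂ⟨X⟩ and (P_w)_{w∈⟨X⟩_d} a family of orthonormal polynomials of τ at degree d. Define the σ(n,d)×σ(n,d) complex matrix U by U_{v,w} := τ(P_v⋆ P_w⋆). Then P_v⋆ = Σ_{w∈⟨X⟩_d} U_{v,w} P_w for every word v of length at most d, U is unitary (U U^† = U^† U = I), and U is symmetric: U_{v,w} = U_{w,v} for all v, w. -/
open scoped ComplexOrder Matrix

namespace NCCD

/-- Words in the letters `X_1, …, X_n`, i.e. elements of the free monoid on `n` generators. -/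
abbrev Word (n : ℕ) : Type := FreeMonoid (Fin n)

/-- The free unital `*`-algebra `ℂ⟨X_1, …, X_n⟩`, modeled as the monoid algebra of the
free monoid on `n` generators. -/
abbrev NCPoly (n : ℕ) : Type := MonoidAlgebra ℂ (Word n)

/-- The monomial associated to a word. -/
noncomputable def mono {n : ℕ} (w : Word n) : NCPoly n :=
  MonoidAlgebra.of ℂ (Word n) w

/-- The length of a word. -/
def wlen {n : ℕ} (w : Word n) : ℕ := (FreeMonoid.toList w).length

/-- The involution `⋆` on `ℂ⟨X⟩`: conjugate the coefficients and reverse the words. -/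
noncomputable def ncStar {n : ℕ} (f : NCPoly n) : NCPoly n :=
  MonoidAlgebra.ofCoeff (Finsupp.mapDomain (fun w => FreeMonoid.ofList (FreeMonoid.toList w).reverse)
    (Finsupp.mapRange (starRingEnd ℂ) (map_zero _) f.coeff))

/-- `τ` is a positive functional: `τ(f⋆ f) ≥ 0` for all `f`. -/
def IsPositive {n : ℕ} (τ : NCPoly n →ₗ[ℂ] ℂ) : Prop :=
  ∀ f : NCPoly n, 0 ≤ τ (ncStar f * f)

/-- `τ` is tracial: `τ(fg) = τ(gf)`. -/
def IsTracial {n : ℕ} (τ : NCPoly n →ₗ[ℂ] ℂ) : Prop :=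
  ∀ f g : NCPoly n, τ (f * g) = τ (g * f)

/-- `τ` is faithful: `τ(f⋆ f) = 0` implies `f = 0`. -/
def IsFaithful {n : ℕ} (τ : NCPoly n →ₗ[ℂ] ℂ) : Prop :=
  ∀ f : NCPoly n, τ (ncStar f * f) = 0 → f = 0

/-- The strict graded lexicographic order on words. -/
def glLt {n : ℕ} (v w : Word n) : Prop :=
  wlen v < wlen w ∨
    (wlen v = wlen w ∧ List.Lex (· < ·) (FreeMonoid.toList v) (FreeMonoid.toList w))

/-- The graded lexicographic order on words. -/
def glLe {n : ℕ} (v w : Word n) : Prop := glLt v w ∨ v = w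

/-- Words of length at most `d`. -/
abbrev WordLE (n d : ℕ) : Type := {w : Word n // wlen w ≤ d}

instance {n : ℕ} : DecidableEq (Word n) := fun a b =>
  decidable_of_iff (FreeMonoid.toList a = FreeMonoid.toList b)
    ⟨fun h => FreeMonoid.toList.injective h, fun h => by rw [h]⟩

instance (n d : ℕ) : Finite (WordLE n d) := by
  apply Finite.of_surjective
    (f := fun p : (k : Fin (d+1)) × (Fin k → Fin n) =>
      (⟨FreeMonoid.ofList (List.ofFn p.2), by simp [wlen]; omega⟩ : WordLE n d))
  rintro ⟨w, hw⟩
  refine ⟨⟨⟨wlen w, by omega⟩, fun i => (FreeMonoid.toList w).get ⟨i, i.2⟩⟩, ?_⟩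
  apply Subtype.ext
  simp [wlen, List.ofFn_get]

noncomputable instance (n d : ℕ) : Fintype (WordLE n d) := Fintype.ofFinite _

/-- The span `ℂ⟨X⟩_d` of the monomials of degree at most `d`. -/
noncomputable def degLE (n d : ℕ) : Submodule ℂ (NCPoly n) :=
  Submodule.span ℂ {p : NCPoly n | ∃ w : Word n, wlen w ≤ d ∧ p = mono w}

end NCCD

namespace NCCD

/-- A family of orthonormal polynomials of a faithful positive tracial state `τ` at degree `d`:
a family `(P_w)` in `ℂ⟨X⟩_d` with `P_1 = 1`, `τ(P_v⋆ P_w) = δ_{v,w}`, `τ(P_v⋆ w) = 0` whenever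
`w <_gl v`, and `τ(P_w⋆ w) > 0`, for all words `v, w` of length at most `d`. -/
def IsONB {n : ℕ} (τ : NCPoly n →ₗ[ℂ] ℂ) (d : ℕ) (P : Word n → NCPoly n) : Prop :=
  (∀ w : Word n, wlen w ≤ d → P w ∈ degLE n d) ∧
  P 1 = 1 ∧
  (∀ v w : Word n, wlen v ≤ d → wlen w ≤ d →
    τ (ncStar (P v) * P w) = if v = w then 1 else 0) ∧
  (∀ v w : Word n, wlen v ≤ d → wlen w ≤ d → glLt w v → τ (ncStar (P v) * mono w) = 0) ∧
  (∀ w : Word n, wlen w ≤ d → 0 < τ (ncStar (P w) * mono w))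

end NCCD

namespace NCCD

theorem ncStar_add {n : ℕ} (f g : NCPoly n) : ncStar (f + g) = ncStar f + ncStar g := by
  unfold ncStar
  rw [MonoidAlgebra.coeff_add, ← MonoidAlgebra.ofCoeff_add, ← Finsupp.mapDomain_add]
  congr 2
  ext a
  simp

theorem ncStar_smul {n : ℕ} (c : ℂ) (f : NCPoly n) :
    ncStar (c • f) = (starRingEnd ℂ) c • ncStar f := by
  unfold ncStar
  rw [MonoidAlgebra.coeff_smul, ← MonoidAlgebra.ofCoeff_smul, ← Finsupp.mapDomain_smul]
  congr 2
  ext a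
  simp

theorem ncStar_zero {n : ℕ} : ncStar (0 : NCPoly n) = 0 := by
  have h := ncStar_smul (0 : ℂ) (0 : NCPoly n)
  simpa using h

theorem ncStar_sum {n : ℕ} {ι : Type*} (s : Finset ι) (f : ι → NCPoly n) :
    ncStar (∑ i ∈ s, f i) = ∑ i ∈ s, ncStar (f i) := by
  classical
  induction s using Finset.induction_on with
  | empty => simp [ncStar_zero]
  | insert a s ha ih => rw [Finset.sum_insert ha, Finset.sum_insert ha, ncStar_add, ih]

theorem ncStar_mono {n : ℕ} (w : Word n) :
    ncStar (mono w) = mono (FreeMonoid.ofList (FreeMonoid.toList w).reverse) := by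
  unfold ncStar mono
  simp [MonoidAlgebra.of_apply, Finsupp.mapDomain_single]

theorem ncStar_ncStar {n : ℕ} (f : NCPoly n) : ncStar (ncStar f) = f := by
  induction f using MonoidAlgebra.induction_on with
  | of w =>
    change ncStar (ncStar (mono w)) = mono w
    rw [ncStar_mono, ncStar_mono]
    simp
  | add f g hf hg => rw [ncStar_add, ncStar_add, hf, hg]
  | smul r f hf => rw [ncStar_smul, ncStar_smul, hf]; simp

theorem ncStar_mem_degLE {n d : ℕ} {f : NCPoly n} (hf : f ∈ degLE n d) :
    ncStar f ∈ degLE n d := by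
  unfold degLE at hf
  induction hf using Submodule.span_induction with
  | mem x hx =>
    obtain ⟨w, hw, rfl⟩ := hx
    rw [ncStar_mono]
    exact Submodule.subset_span ⟨_, by simpa [wlen] using hw, rfl⟩
  | zero => rw [ncStar_zero]; exact zero_mem _
  | add x y _ _ hx hy => rw [ncStar_add]; exact add_mem hx hy
  | smul c x _ hx => rw [ncStar_smul]; exact Submodule.smul_mem _ _ hx

theorem tau_expand {n d : ℕ} (τ : NCPoly n →ₗ[ℂ] ℂ) (P : Word n → NCPoly n)
    (hONB : IsONB τ d P) (c : WordLE n d → ℂ) (v : WordLE n d) :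
    τ (ncStar (P v.1) * ∑ w : WordLE n d, c w • P w.1) = c v := by
  classical
  rw [Finset.mul_sum, map_sum, Finset.sum_eq_single v]
  · rw [mul_smul_comm, map_smul, hONB.2.2.1 v.1 v.1 v.2 v.2]
    simp
  · intro w _ hw
    rw [mul_smul_comm, map_smul, hONB.2.2.1 v.1 w.1 v.2 w.2, if_neg]
    · simp
    · exact fun h => hw (Subtype.ext h.symm)
  · simp

theorem degLE_eq_span {n d : ℕ} (τ : NCPoly n →ₗ[ℂ] ℂ) (P : Word n → NCPoly n)
    (hONB : IsONB τ d P) :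
    Submodule.span ℂ (Set.range fun w : WordLE n d => P w.1) = degLE n d := by
  have hli : LinearIndependent ℂ (fun w : WordLE n d => P w.1) := by
    rw [Fintype.linearIndependent_iff]
    intro c hc v
    have h := tau_expand τ P hONB c v
    rw [hc] at h
    simpa using h.symm
  have hd : degLE n d = Submodule.span ℂ (Set.range fun w : WordLE n d => mono w.1) := by
    unfold degLE
    congr 1
    ext p
    constructor
    · rintro ⟨w, hw, rfl⟩
      exact ⟨⟨w, hw⟩, rfl⟩
    · rintro ⟨w, rfl⟩
      exact ⟨w.1, w.2, rfl⟩
  have : FiniteDimensional ℂ (degLE n d) := by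
    rw [hd]
    exact FiniteDimensional.span_of_finite ℂ (Set.finite_range _)
  apply Submodule.eq_of_le_of_finrank_le
  · rw [Submodule.span_le]
    rintro _ ⟨w, rfl⟩
    exact hONB.1 w.1 w.2
  · rw [finrank_span_eq_card hli, hd]
    exact finrank_range_le_card _

/-- Let `(P_w)` be a family of orthonormal polynomials of a faithful positive
tracial state `τ` at degree `d`, and define `U_{v,w} := τ(P_v⋆ P_w⋆)`. Then
`P_v⋆ = Σ_w U_{v,w} P_w`, `U` is unitary, and `U` is symmetric. -/
theorem adjoint_transition_matrix_unitary_symmetric {n : ℕ} (τ : NCPoly n →ₗ[ℂ] ℂ)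
    (hpos : IsPositive τ) (htr : IsTracial τ) (hstate : τ 1 = 1) (hfaith : IsFaithful τ)
    (d : ℕ) (P : Word n → NCPoly n) (hONB : IsONB τ d P)
    (U : Matrix (WordLE n d) (WordLE n d) ℂ)
    (hU : ∀ v w : WordLE n d, U v w = τ (ncStar (P v.1) * ncStar (P w.1))) :
    (∀ v : WordLE n d, ncStar (P v.1) = ∑ w : WordLE n d, U v w • P w.1) ∧
    U * Uᴴ = 1 ∧ Uᴴ * U = 1 ∧
    (∀ v w : WordLE n d, U v w = U w v) := by
  have hsymm : ∀ v w : WordLE n d, U v w = U w v := fun v w => by rw [hU, hU, htr]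
  have hexp : ∀ v : WordLE n d, ncStar (P v.1) = ∑ w : WordLE n d, U v w • P w.1 := by
    intro v
    have hm := ncStar_mem_degLE (hONB.1 v.1 v.2)
    rw [← degLE_eq_span τ P hONB, Submodule.mem_span_range_iff_exists_fun] at hm
    obtain ⟨c, hc⟩ := hm
    have hcU : ∀ w, U v w = c w := by
      intro w
      rw [hsymm, hU, ← hc, tau_expand τ P hONB]
    simp only [hcU, hc]
  have hUU : U * Uᴴ = 1 := by
    ext v w
    rw [Matrix.mul_apply, Matrix.one_apply]
    have h1 : P w.1 = ∑ u : WordLE n d, (starRingEnd ℂ) (U w u) • ncStar (P u.1) := by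
      rw [← ncStar_ncStar (P w.1), hexp w, ncStar_sum]
      simp only [ncStar_smul]
    have h2 := hONB.2.2.1 v.1 w.1 v.2 w.2
    rw [htr, hexp v] at h2
    nth_rw 1 [h1] at h2
    rw [Finset.sum_mul, map_sum] at h2
    simp only [smul_mul_assoc, map_smul, tau_expand τ P hONB, smul_eq_mul] at h2
    simp only [Matrix.conjTranspose_apply, Subtype.ext_iff]
    rw [← h2]
    exact Finset.sum_congr rfl fun u _ => mul_comm _ _
  exact ⟨hexp, hUU, mul_eq_one_comm.mp hUU, hsymm⟩

end NCCD
end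

section
/- Let K ⊆ ℝ be a nonempty set, d, k ∈ ℕ with k ≥ 1, and c_0, c_1, …, c_d ∈ M_k(ℂ) such that ‖Σ_{j=0}^d x^j · c_j‖ ≤ 1 (operator norm on M_k(ℂ)) for every x ∈ K. Then for every hermitian matrix A ∈ M_k(ℂ) whose spectrum is contained in K, one has tr_k( (Σ_{j=0}^d c_j A^j)^† (Σ_{j=0}^d c_j A^j) ) ≤ 1, where tr_k is the normalized trace on M_k(ℂ) and † denotes conjugate transpose. -/
open scoped ComplexOrder Matrix Matrix.Norms.L2Operator

/-- Let `K ⊆ ℝ` be nonempty and `c_0, …, c_d ∈ M_k(ℂ)` with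
`‖Σ_j x^j c_j‖ ≤ 1` for all `x ∈ K`. Then for every hermitian `A ∈ M_k(ℂ)` whose spectrum
(i.e. whose eigenvalues) lie in `K`, one has `tr_k((Σ_j c_j A^j)† (Σ_j c_j A^j)) ≤ 1`, where
`tr_k` is the normalized trace. -/
theorem single_variable_bound {k d : ℕ} (hk : 1 ≤ k) (K : Set ℝ) (hK : K.Nonempty)
    (c : Fin (d + 1) → Matrix (Fin k) (Fin k) ℂ)
    (hbound : ∀ x ∈ K, ‖∑ j : Fin (d + 1), (x : ℂ) ^ (j : ℕ) • c j‖ ≤ 1)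
    (A : Matrix (Fin k) (Fin k) ℂ) (hA : A.IsHermitian)
    (hspec : ∀ i : Fin k, hA.eigenvalues i ∈ K) :
    (1 / (k : ℂ)) * Matrix.trace
        ((∑ j : Fin (d + 1), c j * A ^ (j : ℕ))ᴴ * ∑ j : Fin (d + 1), c j * A ^ (j : ℕ)) ≤ 1 := by
  set P := ∑ j : Fin (d + 1), c j * A ^ (j : ℕ) with hP
  have hpow : ∀ (i : Fin k) (n : ℕ), (A ^ n) *ᵥ ⇑(hA.eigenvectorBasis i)
      = ((hA.eigenvalues i : ℂ) ^ n) • ⇑(hA.eigenvectorBasis i) := by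
    intro i n
    induction n with
    | zero => simp
    | succ n ih =>
      have h1 := hA.mulVec_eigenvectorBasis i
      have h2 : A *ᵥ ⇑(hA.eigenvectorBasis i)
          = (hA.eigenvalues i : ℂ) • ⇑(hA.eigenvectorBasis i) := by
        rw [h1]; ext a; simp
      rw [pow_succ, ← Matrix.mulVec_mulVec, h2, Matrix.mulVec_smul, ih, smul_smul, pow_succ,
        mul_comm]
  have hPv : ∀ i : Fin k, P *ᵥ ⇑(hA.eigenvectorBasis i)
      = (∑ j : Fin (d + 1), (hA.eigenvalues i : ℂ) ^ (j : ℕ) • c j) *ᵥ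
        ⇑(hA.eigenvectorBasis i) := by
    intro i
    rw [hP, Matrix.sum_mulVec, Matrix.sum_mulVec]
    refine Finset.sum_congr rfl fun j _ => ?_
    rw [← Matrix.mulVec_mulVec, hpow, Matrix.mulVec_smul, Matrix.smul_mulVec]
  have hnorm : ∀ i : Fin k, ‖WithLp.toLp 2 (P *ᵥ ⇑(hA.eigenvectorBasis i))‖ ≤ 1 := by
    intro i
    rw [hPv]
    refine (Matrix.l2_opNorm_mulVec _ (hA.eigenvectorBasis i)).trans ?_
    rw [hA.eigenvectorBasis.orthonormal.1 i, mul_one]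
    exact hbound _ (hspec i)
  set U : Matrix (Fin k) (Fin k) ℂ := (hA.eigenvectorUnitary : Matrix (Fin k) (Fin k) ℂ) with hU
  have hUU : U * Uᴴ = 1 := Unitary.coe_mul_star_self hA.eigenvectorUnitary
  have htr : Matrix.trace (Pᴴ * P) = Matrix.trace ((P * U)ᴴ * (P * U)) := by
    rw [Matrix.conjTranspose_mul, Matrix.mul_assoc, Matrix.trace_mul_comm Uᴴ, ← Matrix.mul_assoc,
      Matrix.mul_assoc, hUU, Matrix.mul_one]
  have hsum : Matrix.trace (Pᴴ * P)
      = ((∑ i, ‖WithLp.toLp 2 (P *ᵥ ⇑(hA.eigenvectorBasis i))‖ ^ 2 : ℝ) : ℂ) := by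
    rw [htr, Matrix.trace, Complex.ofReal_sum]
    refine Finset.sum_congr rfl fun i _ => ?_
    rw [EuclideanSpace.norm_sq_eq, Complex.ofReal_sum, Matrix.diag_apply, Matrix.mul_apply]
    refine Finset.sum_congr rfl fun a _ => ?_
    have : (P * U) a i = (P *ᵥ ⇑(hA.eigenvectorBasis i)) a := by
      simp [Matrix.mul_apply, Matrix.mulVec, dotProduct, hU]
    rw [Matrix.conjTranspose_apply, this, Complex.ofReal_pow]
    exact Complex.conj_mul' _
  rw [hsum]
  have hle : ∑ i, ‖WithLp.toLp 2 (P *ᵥ ⇑(hA.eigenvectorBasis i))‖ ^ 2 ≤ (k : ℝ) := by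
    calc _ ≤ ∑ _i : Fin k, (1 : ℝ) :=
          Finset.sum_le_sum fun i _ => pow_le_one₀ (norm_nonneg _) (hnorm i)
      _ = k := by simp
  have hk' : (0 : ℝ) < k := by exact_mod_cast hk
  have hfin : (1 / (k : ℝ)) * ∑ i, ‖WithLp.toLp 2 (P *ᵥ ⇑(hA.eigenvectorBasis i))‖ ^ 2 ≤ 1 := by
    rw [one_div, inv_mul_le_iff₀ hk', mul_one]
    exact hle
  have hcast := Complex.real_le_real.mpr hfin
  rw [Complex.ofReal_mul, Complex.ofReal_div, Complex.ofReal_one, Complex.ofReal_natCast] at hcast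
  exact hcast
end

section
/- For every d ∈ ℕ and every polynomial P ∈ ℂ[X] of degree at most d, one has (sup_{x∈[-1,1]} |P(x)|)² ≤ (d+1)³ · (2/π) · ∫_{-1}^{1} |P(x)|² √(1-x²) dx. (That is, the standard semicircle distribution on [-1,1] satisfies the Bernstein–Markov inequality with constant M_d = (d+1)^{3/2} at each degree d.) -/
open Polynomial Polynomial.Chebyshev MeasureTheory in
lemma U_orth (j k : ℕ) :
    ∫ x in (-1 : ℝ)..1, ((U ℝ j).eval x * (U ℝ k).eval x) * Real.sqrt (1 - x ^ 2)
      = if j = k then Real.pi / 2 else 0 := by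
  have h1 : ∫ x in (-1 : ℝ)..1, ((U ℝ j).eval x * (U ℝ k).eval x) * Real.sqrt (1 - x ^ 2)
      = ∫ x, (1 - x ^ 2) * ((U ℝ j).eval x * (U ℝ k).eval x) ∂measureT := by
    rw [integral_measureT]
    refine intervalIntegral.integral_congr fun x hx => ?_
    rw [Set.uIcc_of_le (by norm_num)] at hx
    have h0 : 0 ≤ 1 - x ^ 2 := by nlinarith [hx.1, hx.2]
    have : (1 - x ^ 2) * √(1 - x ^ 2)⁻¹ = √(1 - x ^ 2) := by
      rw [Real.sqrt_inv, ← div_eq_mul_inv, Real.div_sqrt]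
    rw [← this]; ring
  have h2 : ∫ x, (1 - x ^ 2) * ((U ℝ j).eval x * (U ℝ k).eval x) ∂measureT
      = ∫ x, (1 / 2 : ℝ) * ((T ℝ ((j : ℤ) - k)).eval x - (T ℝ ((j : ℤ) + k + 2)).eval x)
        ∂measureT := by
    rw [integral_measureT_eq_integral_cos, integral_measureT_eq_integral_cos]
    refine intervalIntegral.integral_congr fun θ _ => ?_
    simp only [T_real_cos]
    have hj := U_real_cos θ j
    have hk := U_real_cos θ k
    push_cast at hj hk ⊢
    have e1 : ((j : ℝ) - k) * θ = (j + 1) * θ - (k + 1) * θ := by ring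
    have e2 : ((j : ℝ) + k + 2) * θ = (j + 1) * θ + (k + 1) * θ := by ring
    rw [e1, e2, Real.cos_sub, Real.cos_add, ← hj, ← hk, ← Real.sin_sq]
    ring
  rw [h1, h2, integral_const_mul, integral_sub (integrable_measureT (by fun_prop))
    (integrable_measureT (by fun_prop)),
    integral_eval_T_real_measureT_of_ne_zero (n := (j : ℤ) + k + 2) (by omega)]
  split_ifs with h
  · subst h
    rw [sub_self, integral_eval_T_real_measureT_zero]; ring
  · rw [integral_eval_T_real_measureT_of_ne_zero (by omega)]; simp

open Polynomial Polynomial.Chebyshev MeasureTheory in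
lemma U_bound (n : ℕ) (x : ℝ) (hx : |x| ≤ 1) : |(U ℝ n).eval x| ≤ n + 1 := by
  induction n with
  | zero => simp
  | succ n ih =>
    push_cast
    rw [U_eq_X_mul_U_add_T]
    simp only [eval_add, eval_mul, eval_X]
    have hT : |(T ℝ ((n : ℤ) + 1)).eval x| ≤ 1 := abs_eval_T_real_le_one _ hx
    calc _ ≤ |x * (U ℝ n).eval x| + |(T ℝ ((n : ℤ) + 1)).eval x| := abs_add_le _ _
      _ ≤ _ := by
        rw [abs_mul]
        nlinarith [abs_nonneg x, abs_nonneg ((U ℝ n).eval x)]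

open Polynomial Polynomial.Chebyshev in
lemma exists_U_expansion (d : ℕ) (P : ℂ[X]) (hP : P.natDegree ≤ d) :
    ∃ c : ℕ → ℂ, P = ∑ k ∈ Finset.range (d + 1), Polynomial.C (c k) * U ℂ k := by
  let S : Polynomial.Sequence ℂ := ⟨fun n => U ℂ n, fun n => degree_U_natCast ℂ n⟩
  have h := S.span_degreeLT (m := d + 1) (fun i _ => by
    change IsUnit (U ℂ i).leadingCoeff
    rw [leadingCoeff_U_natCast]; simp)
  have hm : P ∈ Polynomial.degreeLT ℂ (d + 1) := by
    rw [Polynomial.mem_degreeLT]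
    exact lt_of_le_of_lt (natDegree_le_iff_degree_le.1 hP) (by exact_mod_cast Nat.lt_succ_self d)
  rw [← h, show Set.Iio (d + 1) = ((Finset.range (d + 1) : Finset ℕ) : Set ℕ) by ext; simp,
    Submodule.mem_span_image_finset_iff_exists_fun] at hm
  obtain ⟨c, hc⟩ := hm
  refine ⟨fun k => if h : k ∈ Finset.range (d + 1) then c ⟨k, h⟩ else 0, ?_⟩
  rw [← hc, ← Finset.sum_coe_sort (Finset.range (d + 1))]
  refine Finset.sum_congr rfl fun i _ => ?_
  rw [Polynomial.smul_eq_C_mul]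
  beta_reduce
  rw [dif_pos i.2]

open Polynomial Polynomial.Chebyshev in
lemma real_parseval (s : Finset ℕ) (a : ℕ → ℝ) :
    ∫ x in (-1 : ℝ)..1, (∑ k ∈ s, a k * (U ℝ k).eval x) ^ 2 * Real.sqrt (1 - x ^ 2)
      = Real.pi / 2 * ∑ k ∈ s, a k ^ 2 := by
  have : ∀ x : ℝ, (∑ k ∈ s, a k * (U ℝ k).eval x) ^ 2 * Real.sqrt (1 - x ^ 2)
      = ∑ j ∈ s, ∑ k ∈ s, (a j * a k) *
        (((U ℝ j).eval x * (U ℝ k).eval x) * Real.sqrt (1 - x ^ 2)) := by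
    intro x
    rw [sq, Finset.sum_mul_sum, Finset.sum_mul]
    refine Finset.sum_congr rfl fun j _ => ?_
    rw [Finset.sum_mul]
    exact Finset.sum_congr rfl fun k _ => by ring
  simp_rw [this]
  rw [intervalIntegral.integral_finsetSum
    (fun j _ => Continuous.intervalIntegrable (by fun_prop) _ _), Finset.mul_sum]
  refine Finset.sum_congr rfl fun j hj => ?_
  rw [intervalIntegral.integral_finsetSum
    (fun j _ => Continuous.intervalIntegrable (by fun_prop) _ _)]
  simp_rw [intervalIntegral.integral_const_mul, U_orth]
  simp [hj]
  ring


/-- For every `d ∈ ℕ` and every polynomial `P ∈ ℂ[X]` of degree at most `d`,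
`(sup_{x ∈ [-1,1]} |P(x)|)² ≤ (d+1)³ · (2/π) ∫_{-1}^1 |P(x)|² √(1-x²) dx`, i.e. the standard
semicircle distribution on `[-1,1]` satisfies the Bernstein–Markov inequality with constant
`M_d = (d+1)^{3/2}` at each degree `d`. -/
theorem semicircle_bernstein_markov (d : ℕ) (P : Polynomial ℂ) (hP : P.natDegree ≤ d) :
    (sSup ((fun x : ℝ => ‖P.eval (x : ℂ)‖) '' Set.Icc (-1 : ℝ) 1)) ^ 2 ≤
      ((d : ℝ) + 1) ^ 3 *
        ((2 / Real.pi) *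
          ∫ x in (-1 : ℝ)..1, ‖P.eval (x : ℂ)‖ ^ 2 * Real.sqrt (1 - x ^ 2)) := by
  obtain ⟨c, rfl⟩ := exists_U_expansion d P hP
  clear hP
  have hev : ∀ x : ℝ, (∑ k ∈ Finset.range (d + 1),
      Polynomial.C (c k) * Polynomial.Chebyshev.U ℂ k).eval (x : ℂ)
      = ∑ k ∈ Finset.range (d + 1),
        c k * (((Polynomial.Chebyshev.U ℝ k).eval x : ℝ) : ℂ) := by
    intro x
    rw [Polynomial.eval_finsetSum]
    exact Finset.sum_congr rfl fun k _ => by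
      rw [Polynomial.eval_mul, Polynomial.eval_C, Polynomial.Chebyshev.complex_ofReal_eval_U]
  simp_rw [hev]
  have hint : ∫ x in (-1 : ℝ)..1, ‖∑ k ∈ Finset.range (d + 1),
        c k * (((Polynomial.Chebyshev.U ℝ k).eval x : ℝ) : ℂ)‖ ^ 2 * Real.sqrt (1 - x ^ 2)
      = Real.pi / 2 * ∑ k ∈ Finset.range (d + 1), ‖c k‖ ^ 2 := by
    have : ∀ x : ℝ, ‖∑ k ∈ Finset.range (d + 1),
        c k * (((Polynomial.Chebyshev.U ℝ k).eval x : ℝ) : ℂ)‖ ^ 2 * Real.sqrt (1 - x ^ 2)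
        = (∑ k ∈ Finset.range (d + 1), (c k).re * (Polynomial.Chebyshev.U ℝ k).eval x) ^ 2
            * Real.sqrt (1 - x ^ 2)
          + (∑ k ∈ Finset.range (d + 1), (c k).im * (Polynomial.Chebyshev.U ℝ k).eval x) ^ 2
            * Real.sqrt (1 - x ^ 2) := by
      intro x
      rw [← Complex.normSq_eq_norm_sq, Complex.normSq_apply, Complex.re_sum, Complex.im_sum]
      simp only [Complex.re_mul_ofReal, Complex.im_mul_ofReal]
      ring
    simp_rw [this]
    rw [intervalIntegral.integral_add (Continuous.intervalIntegrable (by fun_prop) _ _)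
      (Continuous.intervalIntegrable (by fun_prop) _ _), real_parseval, real_parseval,
      ← mul_add, ← Finset.sum_add_distrib]
    congr 1
    refine Finset.sum_congr rfl fun k _ => ?_
    rw [← Complex.normSq_eq_norm_sq, Complex.normSq_apply]
    ring
  rw [hint]
  have hpi : 2 / Real.pi * (Real.pi / 2 * ∑ k ∈ Finset.range (d + 1), ‖c k‖ ^ 2)
      = ∑ k ∈ Finset.range (d + 1), ‖c k‖ ^ 2 := by
    have := Real.pi_ne_zero
    field_simp
  rw [hpi]
  set A := ∑ k ∈ Finset.range (d + 1), ‖c k‖ ^ 2 with hA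
  have hA0 : 0 ≤ A := Finset.sum_nonneg fun _ _ => by positivity
  have hR : 0 ≤ ((d : ℝ) + 1) ^ 3 * A := by positivity
  have hsup0 : 0 ≤ sSup ((fun x : ℝ => ‖∑ k ∈ Finset.range (d + 1),
        c k * (((Polynomial.Chebyshev.U ℝ k).eval x : ℝ) : ℂ)‖) '' Set.Icc (-1 : ℝ) 1) :=
    Real.sSup_nonneg (by rintro _ ⟨x, _, rfl⟩; exact norm_nonneg _)
  rw [← Real.le_sqrt hsup0 hR]
  refine csSup_le (Set.Nonempty.image _ ⟨0, by norm_num⟩) ?_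
  rintro _ ⟨x, hx, rfl⟩
  refine Real.le_sqrt_of_sq_le ?_
  have hx' : |x| ≤ 1 := abs_le.2 hx
  have hb : ‖∑ k ∈ Finset.range (d + 1),
        c k * (((Polynomial.Chebyshev.U ℝ k).eval x : ℝ) : ℂ)‖
      ≤ ∑ k ∈ Finset.range (d + 1), ((d : ℝ) + 1) * ‖c k‖ := by
    refine norm_sum_le_of_le _ fun k hk => ?_
    rw [norm_mul, Complex.norm_real, Real.norm_eq_abs, mul_comm]
    refine mul_le_mul_of_nonneg_right ((U_bound k x hx').trans ?_) (norm_nonneg _)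
    have : (k : ℝ) ≤ d := by exact_mod_cast Nat.lt_succ_iff.1 (Finset.mem_range.1 hk)
    linarith
  have hcs := sq_sum_le_card_mul_sum_sq (s := Finset.range (d + 1)) (f := fun k => ‖c k‖)
  rw [Finset.card_range] at hcs
  push_cast at hcs
  rw [← Finset.mul_sum] at hb
  calc _ ≤ (((d : ℝ) + 1) * ∑ k ∈ Finset.range (d + 1), ‖c k‖) ^ 2 :=
        pow_le_pow_left₀ (norm_nonneg _) hb 2
    _ = ((d : ℝ) + 1) ^ 2 * (∑ k ∈ Finset.range (d + 1), ‖c k‖) ^ 2 := by ring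
    _ ≤ ((d : ℝ) + 1) ^ 2 * (((d : ℝ) + 1) * A) :=
        mul_le_mul_of_nonneg_left hcs (by positivity)
    _ = _ := by ring
end
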